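/- arXiv:1301.4729 — 8 statements merged into one kernel-verified Lean document; each statement's English description precedes it below -/
import Mathlib

section
/- With Σ_q^R = ∑_{l=1}^L B_{1,q} H_0^l Σ_l (H_0^l)ᴴ (B_{1,q})ᴴ + ∑_{q'=1}^{q} B_{q',q} W_{q'} (B_{q',q})ᴴ, Ŵ_l' = ∑_{q=1}^Q (H_0^l)ᴴ (B_{1,q})ᴴ Ŵ_q B_{1,q} H_0^l + Ŵ_0^l, and b_{q,q'} = Tr(B_{q,q'} W_q (B_{q,q'})ᴴ Ŵ_{q'}), the following identity holds: ∑_{l=1}^L Tr(Σ_l Ŵ_0^l) + ∑_{q=1}^Q Tr(Σ_q^R Ŵ_q) = ∑_{l=1}^L Tr(Σ_l Ŵ_l') + ∑_{q=1}^Q ∑_{q'=q}^Q b_{q,q'}. (This shows the single network linear constraint of the multi-hop AF relay network coincides with the linear constraint of the equivalent single-hop interference network.) -/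
open Matrix Finset
open scoped ComplexOrder

/-- `Bmat dims F H q q'` is the composite relay matrix `B_{q,q'} = F_{q'} H_{q'-1} ⋯ H_q F_q`
(for `q ≤ q'`; junk values otherwise). -/
noncomputable def Bmat (dims : ℕ → ℕ)
    (F : (q : ℕ) → Matrix (Fin (dims q)) (Fin (dims q)) ℂ)
    (H : (q : ℕ) → Matrix (Fin (dims (q+1))) (Fin (dims q)) ℂ)
    (q : ℕ) : (q' : ℕ) → Matrix (Fin (dims q')) (Fin (dims q)) ℂ
  | 0 => if h : 0 = q then cast (by subst h; rfl) (F q) else 0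
  | (q'' + 1) =>
      if h : q'' + 1 = q then cast (by subst h; rfl) (F q)
      else F (q'' + 1) * H q'' * Bmat dims F H q q''

/-- the single network linear constraint of the multi-hop AF relay network
coincides with the linear constraint of the equivalent single-hop interference network:
`∑_l Tr(Σ_l Ŵ_0^l) + ∑_{q=1}^Q Tr(Σ_q^R Ŵ_q) = ∑_l Tr(Σ_l Ŵ_l') + ∑_{q=1}^Q ∑_{q'=q}^Q b_{q,q'}`. -/
theorem stmt1
    (L Q : ℕ) (hL : 1 ≤ L) (hQ : 1 ≤ Q)
    (dims : ℕ → ℕ) (LT : Fin L → ℕ)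
    (H0 : (l : Fin L) → Matrix (Fin (dims 1)) (Fin (LT l)) ℂ)
    (H : (q : ℕ) → Matrix (Fin (dims (q+1))) (Fin (dims q)) ℂ)
    (F : (q : ℕ) → Matrix (Fin (dims q)) (Fin (dims q)) ℂ)
    (Sig W0hat : (l : Fin L) → Matrix (Fin (LT l)) (Fin (LT l)) ℂ)
    (W What : (q : ℕ) → Matrix (Fin (dims q)) (Fin (dims q)) ℂ)
    (hSig : ∀ l, (Sig l).PosSemidef) (hW0hat : ∀ l, (W0hat l).PosSemidef)
    (hW : ∀ q, 1 ≤ q → q ≤ Q → (W q).PosSemidef)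
    (hWhat : ∀ q, 1 ≤ q → q ≤ Q → (What q).PosSemidef) :
    let B := Bmat dims F H;
    -- covariance of the transmit signal at the q-th relay cluster
    let SigR : (q : ℕ) → Matrix (Fin (dims q)) (Fin (dims q)) ℂ := fun q =>
      (∑ l, B 1 q * H0 l * Sig l * (H0 l)ᴴ * (B 1 q)ᴴ)
        + ∑ q' ∈ Finset.Icc 1 q, B q' q * W q' * (B q' q)ᴴ;
    -- equivalent single-hop constraint matrix Ŵ_l'
    let Whatp : (l : Fin L) → Matrix (Fin (LT l)) (Fin (LT l)) ℂ := fun l =>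
      (∑ q ∈ Finset.Icc 1 Q, (H0 l)ᴴ * (B 1 q)ᴴ * What q * B 1 q * H0 l) + W0hat l;
    let b : ℕ → ℕ → ℂ := fun q q' => (B q q' * W q * (B q q')ᴴ * What q').trace;
    (∑ l, (Sig l * W0hat l).trace) + (∑ q ∈ Finset.Icc 1 Q, (SigR q * What q).trace)
      = (∑ l, (Sig l * Whatp l).trace)
        + ∑ q ∈ Finset.Icc 1 Q, ∑ q' ∈ Finset.Icc q Q, b q q' := by
  intro B SigR Whatp b
  have trace_cycle (l : Fin L) (q : ℕ) :
      (B 1 q * H0 l * Sig l * (H0 l)ᴴ * (B 1 q)ᴴ * What q).trace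
        = (Sig l * ((H0 l)ᴴ * (B 1 q)ᴴ * What q * B 1 q * H0 l)).trace := by
    simp only [Matrix.mul_assoc]
    rw [← Matrix.mul_assoc (B 1 q) (H0 l), Matrix.trace_mul_comm]
    simp only [Matrix.mul_assoc]
  have sum_swap : ∑ q ∈ Finset.Icc 1 Q, ∑ q' ∈ Finset.Icc 1 q, b q' q
      = ∑ q ∈ Finset.Icc 1 Q, ∑ q' ∈ Finset.Icc q Q, b q q' :=
    Finset.sum_comm' fun q q' => by simp only [Finset.mem_Icc]; omega
  have trace_SigR (q : ℕ) : (SigR q * What q).trace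
      = (∑ l, (Sig l * ((H0 l)ᴴ * (B 1 q)ᴴ * What q * B 1 q * H0 l)).trace)
        + ∑ q' ∈ Finset.Icc 1 q, b q' q := by
    simp only [SigR, b, Matrix.add_mul, Matrix.sum_mul, Matrix.trace_add, Matrix.trace_sum,
      trace_cycle]
  have trace_Whatp (l : Fin L) : (Sig l * Whatp l).trace
      = (∑ q ∈ Finset.Icc 1 Q, (Sig l * ((H0 l)ᴴ * (B 1 q)ᴴ * What q * B 1 q * H0 l)).trace)
        + (Sig l * W0hat l).trace := by
    simp only [Whatp, Matrix.mul_add, Matrix.mul_sum, Matrix.trace_add, Matrix.trace_sum]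
  simp only [trace_SigR, trace_Whatp, Finset.sum_add_distrib, sum_swap]
  rw [Finset.sum_comm (s := Finset.Icc 1 Q) (t := Finset.univ)]
  ring
end

section
/- With Σ̂_q^R = ∑_{l=1}^L (B_{q,Q})ᴴ (H_Q^l)ᴴ Σ̂_l H_Q^l B_{q,Q} + ∑_{q'=q}^Q (B_{q,q'})ᴴ Ŵ_{q'} B_{q,q'}, W_l' = ∑_{q=1}^Q H_Q^l B_{q,Q} W_q (B_{q,Q})ᴴ (H_Q^l)ᴴ + W_{Q+1}^l, and b_{q,q'} = Tr(B_{q,q'} W_q (B_{q,q'})ᴴ Ŵ_{q'}), the following identity holds: ∑_{l=1}^L Tr(Σ̂_l W_{Q+1}^l) + ∑_{q=1}^Q Tr(Σ̂_q^R W_q) = ∑_{l=1}^L Tr(Σ̂_l W_l') + ∑_{q=1}^Q ∑_{q'=q}^Q b_{q,q'}. (This shows the single network linear constraint of the dual multi-hop AF relay network coincides with the linear constraint of the dual equivalent single-hop interference network.) -/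
open Matrix Finset
open scoped ComplexOrder

/-- Moving a congruence from one factor of a trace pairing to the other. -/
theorem trace_conjTranspose_mul_mul_mul {m n R : Type*} [Fintype m] [Fintype n]
    [CommSemiring R] [StarRing R] (A : Matrix m n R) (S : Matrix m m R) (W : Matrix n n R) :
    (Aᴴ * S * A * W).trace = (S * (A * W * Aᴴ)).trace := by
  rw [Matrix.mul_assoc, Matrix.mul_assoc, Matrix.trace_mul_comm, Matrix.mul_assoc]

/-- the single network linear constraint of the dual multi-hop AF relay
network coincides with the linear constraint of the dual equivalent single-hop
interference network:
`∑_l Tr(Σ̂_l W_{Q+1}^l) + ∑_{q=1}^Q Tr(Σ̂_q^R W_q) = ∑_l Tr(Σ̂_l W_l') + ∑_{q=1}^Q ∑_{q'=q}^Q b_{q,q'}`. -/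
theorem stmt2
    (L Q : ℕ) (hL : 1 ≤ L) (hQ : 1 ≤ Q)
    (dims : ℕ → ℕ) (LR : Fin L → ℕ)
    (H : (q : ℕ) → Matrix (Fin (dims (q+1))) (Fin (dims q)) ℂ)
    (HQmat : (l : Fin L) → Matrix (Fin (LR l)) (Fin (dims Q)) ℂ)
    (F : (q : ℕ) → Matrix (Fin (dims q)) (Fin (dims q)) ℂ)
    (Sighat WQ1 : (l : Fin L) → Matrix (Fin (LR l)) (Fin (LR l)) ℂ)
    (W What : (q : ℕ) → Matrix (Fin (dims q)) (Fin (dims q)) ℂ)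
    (hSighat : ∀ l, (Sighat l).PosSemidef) (hWQ1 : ∀ l, (WQ1 l).PosSemidef)
    (hW : ∀ q, 1 ≤ q → q ≤ Q → (W q).PosSemidef)
    (hWhat : ∀ q, 1 ≤ q → q ≤ Q → (What q).PosSemidef) :
    let B := Bmat dims F H;
    -- covariance of the transmit signal at the q-th relay cluster of the dual network
    let SighatR : (q : ℕ) → Matrix (Fin (dims q)) (Fin (dims q)) ℂ := fun q =>
      (∑ l, (B q Q)ᴴ * (HQmat l)ᴴ * Sighat l * HQmat l * B q Q)
        + ∑ q' ∈ Finset.Icc q Q, (B q q')ᴴ * What q' * B q q';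
    -- equivalent single-hop noise covariance W_l'
    let Wp : (l : Fin L) → Matrix (Fin (LR l)) (Fin (LR l)) ℂ := fun l =>
      (∑ q ∈ Finset.Icc 1 Q, HQmat l * B q Q * W q * (B q Q)ᴴ * (HQmat l)ᴴ) + WQ1 l;
    let b : ℕ → ℕ → ℂ := fun q q' => (B q q' * W q * (B q q')ᴴ * What q').trace;
    (∑ l, (Sighat l * WQ1 l).trace) + (∑ q ∈ Finset.Icc 1 Q, (SighatR q * W q).trace)
      = (∑ l, (Sighat l * Wp l).trace)
        + ∑ q ∈ Finset.Icc 1 Q, ∑ q' ∈ Finset.Icc q Q, b q q' := by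
  intro B SighatR Wp b
  have h_primal : ∀ l, (Sighat l * Wp l).trace
      = (∑ q ∈ Finset.Icc 1 Q,
          ((HQmat l * B q Q)ᴴ * Sighat l * (HQmat l * B q Q) * W q).trace)
        + (Sighat l * WQ1 l).trace := by
    intro l
    simp only [Wp, Matrix.mul_add, Matrix.trace_add, Matrix.mul_sum, Matrix.trace_sum,
      trace_conjTranspose_mul_mul_mul]
    simp only [Matrix.conjTranspose_mul, Matrix.mul_assoc]
  have h_dual : ∀ q, (SighatR q * W q).trace
      = (∑ l, ((HQmat l * B q Q)ᴴ * Sighat l * (HQmat l * B q Q) * W q).trace)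
        + ∑ q' ∈ Finset.Icc q Q, b q q' := by
    intro q
    simp only [SighatR, b, Matrix.add_mul, Matrix.trace_add, Matrix.sum_mul, Matrix.trace_sum]
    congr 1
    · simp only [Matrix.conjTranspose_mul, Matrix.mul_assoc]
    · refine Finset.sum_congr rfl fun q' _ => ?_
      rw [trace_conjTranspose_mul_mul_mul, Matrix.trace_mul_comm]
  simp only [h_primal, h_dual, Finset.sum_add_distrib]
  rw [Finset.sum_comm (s := Finset.Icc 1 Q)]
  ring
end

section
/- (Power-conservation part of the Type I duality.) Define Σ_q^R = ∑_{l=1}^L B_{1,q} H_0^l Σ_l (H_0^l)ᴴ (B_{1,q})ᴴ + ∑_{q'=1}^{q} B_{q',q} W_{q'} (B_{q',q})ᴴ, Σ̂_q^R = ∑_{l=1}^L (B_{q,Q})ᴴ (H_Q^l)ᴴ Σ̂_l H_Q^l B_{q,Q} + ∑_{q'=q}^Q (B_{q,q'})ᴴ Ŵ_{q'} B_{q,q'}, Ŵ_l' = ∑_{q=1}^Q (H_0^l)ᴴ (B_{1,q})ᴴ Ŵ_q B_{1,q} H_0^l + Ŵ_0^l, and W_l' = ∑_{q=1}^Q H_Q^l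 B_{q,Q} W_q (B_{q,Q})ᴴ (H_Q^l)ᴴ + W_{Q+1}^l. If the equivalent single-hop powers are conserved, i.e. ∑_{l=1}^L Tr(Σ̂_l W_l') = ∑_{l=1}^L Tr(Σ_l Ŵ_l'), then the multi-hop network powers are conserved: ∑_{l=1}^L Tr(Σ̂_l W_{Q+1}^l) + ∑_{q=1}^Q Tr(Σ̂_q^R W_q) = ∑_{l=1}^L Tr(Σ_l Ŵ_0^l) + ∑_{q=1}^Q Tr(Σ_q^R Ŵ_q). -/
open Matrix Finset
open scoped ComplexOrder

/-- The trace is unchanged when the factors `A`, `Aᴴ` of a congruence are moved across. -/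
theorem trace_congruence_mul {m n : Type*} [Fintype m] [Fintype n]
    (A : Matrix m n ℂ) (X : Matrix n n ℂ) (Y : Matrix m m ℂ) :
    (A * X * Aᴴ * Y).trace = (Aᴴ * Y * A * X).trace := by
  rw [Matrix.mul_assoc (A * X), Matrix.trace_mul_comm, ← Matrix.mul_assoc]

/-- power-conservation part of the Type I duality: if the equivalent
single-hop powers are conserved, `∑_l Tr(Σ̂_l W_l') = ∑_l Tr(Σ_l Ŵ_l')`, then the
multi-hop network powers are conserved:
`∑_l Tr(Σ̂_l W_{Q+1}^l) + ∑_q Tr(Σ̂_q^R W_q) = ∑_l Tr(Σ_l Ŵ_0^l) + ∑_q Tr(Σ_q^R Ŵ_q)`. -/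
theorem stmt3
    (L Q : ℕ) (hL : 1 ≤ L) (hQ : 1 ≤ Q)
    (dims : ℕ → ℕ) (LT LR : Fin L → ℕ)
    (H0 : (l : Fin L) → Matrix (Fin (dims 1)) (Fin (LT l)) ℂ)
    (H : (q : ℕ) → Matrix (Fin (dims (q+1))) (Fin (dims q)) ℂ)
    (HQmat : (l : Fin L) → Matrix (Fin (LR l)) (Fin (dims Q)) ℂ)
    (F : (q : ℕ) → Matrix (Fin (dims q)) (Fin (dims q)) ℂ)
    (Sig W0hat : (l : Fin L) → Matrix (Fin (LT l)) (Fin (LT l)) ℂ)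
    (Sighat WQ1 : (l : Fin L) → Matrix (Fin (LR l)) (Fin (LR l)) ℂ)
    (W What : (q : ℕ) → Matrix (Fin (dims q)) (Fin (dims q)) ℂ)
    (hSig : ∀ l, (Sig l).PosSemidef) (hW0hat : ∀ l, (W0hat l).PosSemidef)
    (hSighat : ∀ l, (Sighat l).PosSemidef) (hWQ1 : ∀ l, (WQ1 l).PosSemidef)
    (hW : ∀ q, 1 ≤ q → q ≤ Q → (W q).PosSemidef)
    (hWhat : ∀ q, 1 ≤ q → q ≤ Q → (What q).PosSemidef) :
    let B := Bmat dims F H;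
    let SigR : (q : ℕ) → Matrix (Fin (dims q)) (Fin (dims q)) ℂ := fun q =>
      (∑ l, B 1 q * H0 l * Sig l * (H0 l)ᴴ * (B 1 q)ᴴ)
        + ∑ q' ∈ Finset.Icc 1 q, B q' q * W q' * (B q' q)ᴴ;
    let SighatR : (q : ℕ) → Matrix (Fin (dims q)) (Fin (dims q)) ℂ := fun q =>
      (∑ l, (B q Q)ᴴ * (HQmat l)ᴴ * Sighat l * HQmat l * B q Q)
        + ∑ q' ∈ Finset.Icc q Q, (B q q')ᴴ * What q' * B q q';
    let Whatp : (l : Fin L) → Matrix (Fin (LT l)) (Fin (LT l)) ℂ := fun l =>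
      (∑ q ∈ Finset.Icc 1 Q, (H0 l)ᴴ * (B 1 q)ᴴ * What q * B 1 q * H0 l) + W0hat l;
    let Wp : (l : Fin L) → Matrix (Fin (LR l)) (Fin (LR l)) ℂ := fun l =>
      (∑ q ∈ Finset.Icc 1 Q, HQmat l * B q Q * W q * (B q Q)ᴴ * (HQmat l)ᴴ) + WQ1 l;
    (∑ l, (Sighat l * Wp l).trace) = (∑ l, (Sig l * Whatp l).trace) →
    (∑ l, (Sighat l * WQ1 l).trace) + (∑ q ∈ Finset.Icc 1 Q, (SighatR q * W q).trace)
      = (∑ l, (Sig l * W0hat l).trace)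
        + ∑ q ∈ Finset.Icc 1 Q, (SigR q * What q).trace := by
  intro B SigR SighatR Whatp Wp h
  have hRx : ∀ l, (Sighat l * Wp l).trace =
      (∑ q ∈ Finset.Icc 1 Q, ((B q Q)ᴴ * (HQmat l)ᴴ * Sighat l * HQmat l * B q Q * W q).trace)
        + (Sighat l * WQ1 l).trace := by
    intro l
    simp only [Wp, Matrix.mul_add, Matrix.trace_add, Matrix.mul_sum, Matrix.trace_sum]
    congr 1
    refine Finset.sum_congr rfl fun q _ => ?_
    have := trace_congruence_mul (HQmat l * B q Q) (W q) (Sighat l)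
    rw [Matrix.trace_mul_comm]
    simpa only [Matrix.conjTranspose_mul, Matrix.mul_assoc] using this
  have hTx : ∀ l, (Sig l * Whatp l).trace =
      (∑ q ∈ Finset.Icc 1 Q, (B 1 q * H0 l * Sig l * (H0 l)ᴴ * (B 1 q)ᴴ * What q).trace)
        + (Sig l * W0hat l).trace := by
    intro l
    simp only [Whatp, Matrix.mul_add, Matrix.trace_add, Matrix.mul_sum, Matrix.trace_sum]
    congr 1
    refine Finset.sum_congr rfl fun q _ => ?_
    have := trace_congruence_mul (B 1 q * H0 l) (Sig l) (What q)
    rw [Matrix.trace_mul_comm]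
    simpa only [Matrix.conjTranspose_mul, Matrix.mul_assoc] using this.symm
  have hcross :
      (∑ q ∈ Finset.Icc 1 Q, ∑ q' ∈ Finset.Icc q Q, ((B q q')ᴴ * What q' * B q q' * W q).trace)
        = ∑ q ∈ Finset.Icc 1 Q, ∑ q' ∈ Finset.Icc 1 q,
            (B q' q * W q' * (B q' q)ᴴ * What q).trace := by
    simp only [trace_congruence_mul]
    refine Finset.sum_comm' fun q q' => ?_
    simp only [Finset.mem_Icc]
    omega
  simp only [hRx, hTx, Finset.sum_add_distrib] at h
  rw [Finset.sum_comm, Finset.sum_comm (s := Finset.univ) (t := Finset.Icc 1 Q)] at h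
  simp only [SigR, SighatR, Matrix.add_mul, Matrix.trace_add, Matrix.sum_mul, Matrix.trace_sum,
    Finset.sum_add_distrib]
  linear_combination h + hcross
end

section
/- (Power identity for the scaled dual network, eq. (SNLCfixd) of Corollary 1.) Let d ∈ ℝ^{Q+1} with d_{Q+1} = 1 and all d_q > 0. Define Σ_q^R = ∑_{l=1}^L B_{1,q} H_0^l Σ_l (H_0^l)ᴴ (B_{1,q})ᴴ + ∑_{q'=1}^{q} B_{q',q} W_{q'} (B_{q',q})ᴴ, Σ̂_q^R(d) = ∑_{l=1}^L (B_{q,Q})ᴴ (H_Q^l)ᴴ Σ̂_l H_Q^l B_{q,Q} + ∑_{q'=q}^Q d_{q'+1} (B_{q,q'})ᴴ Ŵ_{q'} B_{q,q'}, Ŵ_l'(d) = ∑_{q=1}^Q d_{q+1} (H_0^l)ᴴ (B_{1,q})ᴴ Ŵ_q B_{1,q} H_0^l + d_1 Ŵ_0^l, W_l' = ∑_{q=1}^Q H_Q^l B_{q,Q} W_q (B_{q,Q})ᴴ (H_Q^l)ᴴ + W_{Q+1}^l, P_0^tx = ∑_{l=1}^L Tr(Σ_l Ŵ_0^l) and P_q^tx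 = Tr(Σ_q^R Ŵ_q) for q = 1,…,Q. If ∑_{l=1}^L Tr(Σ̂_l W_l') = ∑_{l=1}^L Tr(Σ_l Ŵ_l'(d)), then ∑_{l=1}^L Tr(Σ̂_l W_{Q+1}^l) + ∑_{q=1}^Q Tr(Σ̂_q^R(d) W_q) = ∑_{q=0}^{Q} d_{q+1} P_q^tx. -/
open Matrix Finset
open scoped ComplexOrder

/-- power identity for the scaled dual network, eq. (SNLCfixd) of
Corollary 1: if `∑_l Tr(Σ̂_l W_l') = ∑_l Tr(Σ_l Ŵ_l'(d))`, then
`∑_l Tr(Σ̂_l W_{Q+1}^l) + ∑_{q=1}^Q Tr(Σ̂_q^R(d) W_q) = ∑_{q=0}^Q d_{q+1} P_q^tx`. -/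
theorem stmt4
    (L Q : ℕ) (hL : 1 ≤ L) (hQ : 1 ≤ Q)
    (dims : ℕ → ℕ) (LT LR : Fin L → ℕ)
    (H0 : (l : Fin L) → Matrix (Fin (dims 1)) (Fin (LT l)) ℂ)
    (H : (q : ℕ) → Matrix (Fin (dims (q+1))) (Fin (dims q)) ℂ)
    (HQmat : (l : Fin L) → Matrix (Fin (LR l)) (Fin (dims Q)) ℂ)
    (F : (q : ℕ) → Matrix (Fin (dims q)) (Fin (dims q)) ℂ)
    (Sig W0hat : (l : Fin L) → Matrix (Fin (LT l)) (Fin (LT l)) ℂ)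
    (Sighat WQ1 : (l : Fin L) → Matrix (Fin (LR l)) (Fin (LR l)) ℂ)
    (W What : (q : ℕ) → Matrix (Fin (dims q)) (Fin (dims q)) ℂ)
    (hSig : ∀ l, (Sig l).PosSemidef) (hW0hat : ∀ l, (W0hat l).PosSemidef)
    (hSighat : ∀ l, (Sighat l).PosSemidef) (hWQ1 : ∀ l, (WQ1 l).PosSemidef)
    (hW : ∀ q, 1 ≤ q → q ≤ Q → (W q).PosSemidef)
    (hWhat : ∀ q, 1 ≤ q → q ≤ Q → (What q).PosSemidef)
    (d : ℕ → ℝ) (hdlast : d (Q + 1) = 1)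
    (hdpos : ∀ q, 1 ≤ q → q ≤ Q + 1 → 0 < d q) :
    let B := Bmat dims F H;
    let SigR : (q : ℕ) → Matrix (Fin (dims q)) (Fin (dims q)) ℂ := fun q =>
      (∑ l, B 1 q * H0 l * Sig l * (H0 l)ᴴ * (B 1 q)ᴴ)
        + ∑ q' ∈ Finset.Icc 1 q, B q' q * W q' * (B q' q)ᴴ;
    let SighatRd : (q : ℕ) → Matrix (Fin (dims q)) (Fin (dims q)) ℂ := fun q =>
      (∑ l, (B q Q)ᴴ * (HQmat l)ᴴ * Sighat l * HQmat l * B q Q)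
        + ∑ q' ∈ Finset.Icc q Q, (d (q' + 1) : ℂ) • ((B q q')ᴴ * What q' * B q q');
    let Whatpd : (l : Fin L) → Matrix (Fin (LT l)) (Fin (LT l)) ℂ := fun l =>
      (∑ q ∈ Finset.Icc 1 Q, (d (q + 1) : ℂ) • ((H0 l)ᴴ * (B 1 q)ᴴ * What q * B 1 q * H0 l))
        + (d 1 : ℂ) • W0hat l;
    let Wp : (l : Fin L) → Matrix (Fin (LR l)) (Fin (LR l)) ℂ := fun l =>
      (∑ q ∈ Finset.Icc 1 Q, HQmat l * B q Q * W q * (B q Q)ᴴ * (HQmat l)ᴴ) + WQ1 l;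
    let P0tx : ℂ := ∑ l, (Sig l * W0hat l).trace;
    let Ptx : ℕ → ℂ := fun q => (SigR q * What q).trace;
    (∑ l, (Sighat l * Wp l).trace) = (∑ l, (Sig l * Whatpd l).trace) →
    (∑ l, (Sighat l * WQ1 l).trace) + (∑ q ∈ Finset.Icc 1 Q, (SighatRd q * W q).trace)
      = (d 1 : ℂ) * P0tx + ∑ q ∈ Finset.Icc 1 Q, (d (q + 1) : ℂ) * Ptx q := by
  intro B SigR SighatRd Whatpd Wp P0tx Ptx h
  have hl : (∑ l, (Sighat l * WQ1 l).trace) + (∑ q ∈ Finset.Icc 1 Q, (SighatRd q * W q).trace)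
      = (∑ l, (Sighat l * Wp l).trace) + ∑ q ∈ Finset.Icc 1 Q, ∑ q' ∈ Finset.Icc q Q,
        (d (q' + 1) : ℂ) * ((B q q')ᴴ * What q' * B q q' * W q).trace := by
    simp only [SighatRd, Wp, Matrix.add_mul, Matrix.mul_add, Matrix.trace_add, Matrix.sum_mul,
      Matrix.mul_sum, Matrix.trace_sum, Matrix.smul_mul, Matrix.trace_smul, smul_eq_mul,
      Finset.sum_add_distrib]
    rw [Finset.sum_comm (s := Finset.Icc 1 Q) (t := Finset.univ), ← add_assoc]
    congr 1
    rw [add_comm]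
    congr 1
    refine Finset.sum_congr rfl fun l _ => Finset.sum_congr rfl fun q _ => ?_
    have e := Matrix.trace_mul_comm ((B q Q)ᴴ * (HQmat l)ᴴ) (Sighat l * HQmat l * B q Q * W q)
    simpa only [Matrix.mul_assoc] using e
  have hr : (d 1 : ℂ) * P0tx + ∑ q ∈ Finset.Icc 1 Q, (d (q + 1) : ℂ) * Ptx q
      = (∑ l, (Sig l * Whatpd l).trace) + ∑ q ∈ Finset.Icc 1 Q, ∑ q' ∈ Finset.Icc 1 q,
        (d (q + 1) : ℂ) * ((B q' q)ᴴ * What q * B q' q * W q').trace := by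
    simp only [SigR, Ptx, P0tx, Whatpd, Matrix.add_mul, Matrix.trace_add,
      Matrix.sum_mul, Matrix.trace_sum, Matrix.mul_smul, Matrix.trace_smul,
      smul_eq_mul, Finset.sum_add_distrib, mul_add, Finset.mul_sum]
    rw [Finset.sum_comm (s := Finset.Icc 1 Q) (t := Finset.univ), ← add_assoc]
    congr 1
    · rw [add_comm]
      congr 1
      refine Finset.sum_congr rfl fun l _ => Finset.sum_congr rfl fun q _ => ?_
      have e := Matrix.trace_mul_comm (B 1 q * H0 l) (Sig l * (H0 l)ᴴ * (B 1 q)ᴴ * What q)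
      congr 1
      simpa only [Matrix.mul_assoc] using e
    · refine Finset.sum_congr rfl fun q _ => Finset.sum_congr rfl fun q' _ => ?_
      have e := Matrix.trace_mul_comm (B q' q * W q') ((B q' q)ᴴ * What q)
      congr 1
      simpa only [Matrix.mul_assoc] using e
  rw [hl, hr, h]
  congr 1
  refine Finset.sum_comm' fun q q' => ?_
  simp only [Finset.mem_Icc]
  omega
end

section
/- (Polite water-filling structure of the dual covariance, core identity of Corollary 2.) Let Ω ∈ ℂ^{n×n} and Ω̂ ∈ ℂ^{m×m} be Hermitian positive definite, Ȟ ∈ ℂ^{n×m}, and w > 0 a real number. Suppose E ∈ ℂ^{n×r} and G ∈ ℂ^{m×r} satisfy EᴴE = I_r and GᴴG = I_r, and Δ ∈ ℝ^{r×r} is a diagonal matrix with strictly positive diagonal entries δ_1,…,δ_r, such that Ω^{-1/2} Ȟ Ω̂^{-1/2} = E Δ Gᴴ. Let P be the r×r diagonal matrix with diagonal entries max(w − δ_i^{-2}, 0). Define Σ = Ω̂^{-1/2} G P Gᴴ Ω̂^{-1/2} and Σ̂ = w(Ω^{-1} − (Ω + Ȟ Σ Ȟᴴ)^{-1}). Then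 Ω^{1/2} Σ̂ Ω^{1/2} = E P Eᴴ. -/
open Matrix
open scoped ComplexOrder

/-- The inverse of `S (1 + E Q Eᴴ) S` when `E` has orthonormal columns and `Q = R + Q R`. -/
theorem Matrix.inv_conj_one_add_isometry {n r : Type*} [Fintype n] [DecidableEq n] [Fintype r]
    [DecidableEq r] {𝕜 : Type*} [CommRing 𝕜] [StarRing 𝕜]
    (S : Matrix n n 𝕜) {E : Matrix n r 𝕜} (hE : Eᴴ * E = 1)
    {Q R : Matrix r r 𝕜} (hQR : Q = R + Q * R) :
    (S * (1 + E * Q * Eᴴ) * S)⁻¹ = S⁻¹ * (1 - E * R * Eᴴ) * S⁻¹ := by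
  have key : (1 + E * Q * Eᴴ) * (1 - E * R * Eᴴ) = 1 := by
    have h : E * Q * Eᴴ * (E * R * Eᴴ) = E * (Q * R) * Eᴴ := by
      calc E * Q * Eᴴ * (E * R * Eᴴ) = E * Q * (Eᴴ * E) * R * Eᴴ := by
            simp only [Matrix.mul_assoc]
        _ = E * (Q * R) * Eᴴ := by rw [hE, Matrix.mul_one, Matrix.mul_assoc E Q R]
    have h' : E * Q * Eᴴ = E * R * Eᴴ + E * (Q * R) * Eᴴ := by
      conv_lhs => rw [hQR]
      rw [Matrix.mul_add, Matrix.add_mul]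
    rw [add_mul, one_mul, mul_sub, mul_one, h, h']
    abel
  rw [Matrix.mul_inv_rev, Matrix.mul_inv_rev, Matrix.inv_eq_right_inv key,
    ← Matrix.mul_assoc S⁻¹]

/-- The scalar water-filling identity. -/
theorem waterfill_identity {w d : ℝ} (hw : 0 < w) (hd : 0 < d) :
    d * max (w - (d ^ 2)⁻¹) 0 * d = w⁻¹ * max (w - (d ^ 2)⁻¹) 0 +
      d * max (w - (d ^ 2)⁻¹) 0 * d * (w⁻¹ * max (w - (d ^ 2)⁻¹) 0) := by
  rcases max_choice (w - (d ^ 2)⁻¹) 0 with h | h <;> rw [h]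
  · field_simp
    ring
  · simp

/-- polite water-filling structure of the dual covariance, core identity of
Corollary 2: with `Ωs = Ω^{1/2}` and `Ωhs = Ω̂^{1/2}` the (unique) Hermitian positive
definite square roots, the thin SVD `Ω^{-1/2} Ȟ Ω̂^{-1/2} = E Δ Gᴴ`,
`P = diag(max(w − δ_i⁻², 0))`, `Σ = Ω̂^{-1/2} G P Gᴴ Ω̂^{-1/2}` and
`Σ̂ = w(Ω⁻¹ − (Ω + Ȟ Σ Ȟᴴ)⁻¹)`, one has `Ω^{1/2} Σ̂ Ω^{1/2} = E P Eᴴ`. -/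
theorem stmt9 (n m r : ℕ)
    (Ω Ωs : Matrix (Fin n) (Fin n) ℂ) (hΩ : Ω.PosDef)
    (hΩs : Ωs.PosDef) (hΩssq : Ωs * Ωs = Ω)
    (Ωh Ωhs : Matrix (Fin m) (Fin m) ℂ) (hΩh : Ωh.PosDef)
    (hΩhs : Ωhs.PosDef) (hΩhssq : Ωhs * Ωhs = Ωh)
    (Hc : Matrix (Fin n) (Fin m) ℂ)
    (w : ℝ) (hw : 0 < w)
    (E : Matrix (Fin n) (Fin r) ℂ) (G : Matrix (Fin m) (Fin r) ℂ)
    (hE : Eᴴ * E = 1) (hG : Gᴴ * G = 1)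
    (δ : Fin r → ℝ) (hδ : ∀ i, 0 < δ i)
    (hSVD : Ωs⁻¹ * Hc * Ωhs⁻¹ = E * Matrix.diagonal (fun i => ((δ i : ℝ) : ℂ)) * Gᴴ) :
    let P : Matrix (Fin r) (Fin r) ℂ :=
      Matrix.diagonal fun i => ((max (w - ((δ i) ^ 2)⁻¹) 0 : ℝ) : ℂ);
    let Sig : Matrix (Fin m) (Fin m) ℂ := Ωhs⁻¹ * G * P * Gᴴ * Ωhs⁻¹;
    let Sighat : Matrix (Fin n) (Fin n) ℂ := (w : ℂ) • (Ω⁻¹ - (Ω + Hc * Sig * Hcᴴ)⁻¹);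
    Ωs * Sighat * Ωs = E * P * Eᴴ := by
  intro P Sig Sighat
  have hS : IsUnit Ωs.det := (Matrix.isUnit_iff_isUnit_det _).1 hΩs.isUnit
  have hT : IsUnit Ωhs.det := (Matrix.isUnit_iff_isUnit_det _).1 hΩhs.isUnit
  set D : Matrix (Fin r) (Fin r) ℂ := Matrix.diagonal fun i => ((δ i : ℝ) : ℂ) with hD
  have hDH : Dᴴ = D := by
    rw [hD, Matrix.diagonal_conjTranspose]
    congr 1
    ext i
    simp
  have hHc : Hc = Ωs * (E * D * Gᴴ) * Ωhs := by
    rw [← hSVD, Matrix.mul_assoc Ωs⁻¹, Matrix.mul_nonsing_inv_cancel_left _ _ hS,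
      Matrix.nonsing_inv_mul_cancel_right _ _ hT]
  have hHcH : Hcᴴ = Ωhs * (G * D * Eᴴ) * Ωs := by
    rw [hHc]
    simp only [Matrix.conjTranspose_mul, Matrix.conjTranspose_conjTranspose, hDH,
      hΩs.isHermitian.eq, hΩhs.isHermitian.eq, Matrix.mul_assoc]
  have hsum : Ω + Hc * Sig * Hcᴴ = Ωs * (1 + E * (D * P * D) * Eᴴ) * Ωs := by
    have h : Hc * Sig * Hcᴴ = Ωs * (E * (D * P * D) * Eᴴ) * Ωs := by
      calc Hc * Sig * Hcᴴ
          = Ωs * E * D * Gᴴ * (Ωhs * Ωhs⁻¹) * G * P * Gᴴ * (Ωhs⁻¹ * Ωhs) * G * D * Eᴴ * Ωs := by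
            rw [hHcH, hHc]
            simp only [Sig, Matrix.mul_assoc]
        _ = Ωs * E * D * (Gᴴ * G) * P * (Gᴴ * G) * D * Eᴴ * Ωs := by
            rw [Matrix.mul_nonsing_inv _ hT, Matrix.nonsing_inv_mul _ hT]
            simp only [Matrix.mul_assoc, Matrix.one_mul]
        _ = Ωs * (E * (D * P * D) * Eᴴ) * Ωs := by
            rw [hG]
            simp only [Matrix.mul_assoc, Matrix.one_mul]
    rw [h, ← hΩssq, Matrix.mul_add, Matrix.add_mul, Matrix.mul_one]
  have hQR : D * P * D = (w : ℂ)⁻¹ • P + D * P * D * ((w : ℂ)⁻¹ • P) := by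
    simp only [hD, P, Matrix.diagonal_mul_diagonal, ← Matrix.diagonal_smul,
      Matrix.diagonal_add]
    congr 1
    ext i
    simp only [Pi.smul_apply, smul_eq_mul]
    exact_mod_cast waterfill_identity hw (hδ i)
  have hw' : (w : ℂ) ≠ 0 := by exact_mod_cast hw.ne'
  have hdiff : Ω⁻¹ - (Ω + Hc * Sig * Hcᴴ)⁻¹ = Ωs⁻¹ * ((w : ℂ)⁻¹ • (E * P * Eᴴ)) * Ωs⁻¹ := by
    rw [hsum, Matrix.inv_conj_one_add_isometry Ωs hE hQR, ← hΩssq, Matrix.mul_inv_rev,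
      Matrix.mul_sub, Matrix.sub_mul, Matrix.mul_one, sub_sub_cancel, Matrix.mul_smul,
      Matrix.smul_mul]
  simp only [Sighat]
  rw [hdiff, Matrix.mul_smul, Matrix.smul_mul, Matrix.mul_assoc Ωs⁻¹,
    Matrix.mul_nonsing_inv_cancel_left _ _ hS, Matrix.nonsing_inv_mul_cancel_right _ _ hS,
    smul_smul, mul_inv_cancel₀ hw', one_smul]
end

section
/- (Reciprocity identity (KeyEqGFequ) for polite water-filling covariances.) Let Ω ∈ ℂ^{n×n} and Ω̂ ∈ ℂ^{m×m} be Hermitian positive definite, Ȟ ∈ ℂ^{n×m}, and w > 0 a real number. Suppose E ∈ ℂ^{n×r} and G ∈ ℂ^{m×r} satisfy EᴴE = I_r and GᴴG = I_r, and Δ ∈ ℝ^{r×r} is a diagonal matrix with strictly positive diagonal entries δ_1,…,δ_r, such that Ω^{-1/2} Ȟ Ω̂^{-1/2} = E Δ Gᴴ. Let P be the r×r diagonal matrix with diagonal entries max(w − δ_i^{-2}, 0), and define Σ = Ω̂^{-1/2} G P Gᴴ Ω̂^{-1/2} and Σ̂ = Ω^{-1/2} E P Eᴴ Ω^{-1/2}.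 Then Ω^{-1} Ȟ Σ = Σ̂ Ȟ Ω̂^{-1}. -/
open Matrix
open scoped ComplexOrder

/-- reciprocity identity (KeyEqGFequ) for polite water-filling
covariances: with `Ωs = Ω^{1/2}`, `Ωhs = Ω̂^{1/2}` the (unique) Hermitian positive
definite square roots, the thin SVD `Ω^{-1/2} Ȟ Ω̂^{-1/2} = E Δ Gᴴ`,
`P = diag(max(w − δ_i⁻², 0))`, `Σ = Ω̂^{-1/2} G P Gᴴ Ω̂^{-1/2}` and
`Σ̂ = Ω^{-1/2} E P Eᴴ Ω^{-1/2}`, one has `Ω⁻¹ Ȟ Σ = Σ̂ Ȟ Ω̂⁻¹`. -/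
theorem stmt10 (n m r : ℕ)
    (Ω Ωs : Matrix (Fin n) (Fin n) ℂ) (hΩ : Ω.PosDef)
    (hΩs : Ωs.PosDef) (hΩssq : Ωs * Ωs = Ω)
    (Ωh Ωhs : Matrix (Fin m) (Fin m) ℂ) (hΩh : Ωh.PosDef)
    (hΩhs : Ωhs.PosDef) (hΩhssq : Ωhs * Ωhs = Ωh)
    (Hc : Matrix (Fin n) (Fin m) ℂ)
    (w : ℝ) (hw : 0 < w)
    (E : Matrix (Fin n) (Fin r) ℂ) (G : Matrix (Fin m) (Fin r) ℂ)
    (hE : Eᴴ * E = 1) (hG : Gᴴ * G = 1)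
    (δ : Fin r → ℝ) (hδ : ∀ i, 0 < δ i)
    (hSVD : Ωs⁻¹ * Hc * Ωhs⁻¹ = E * Matrix.diagonal (fun i => ((δ i : ℝ) : ℂ)) * Gᴴ) :
    let P : Matrix (Fin r) (Fin r) ℂ :=
      Matrix.diagonal fun i => ((max (w - ((δ i) ^ 2)⁻¹) 0 : ℝ) : ℂ);
    let Sig : Matrix (Fin m) (Fin m) ℂ := Ωhs⁻¹ * G * P * Gᴴ * Ωhs⁻¹;
    let Sighat : Matrix (Fin n) (Fin n) ℂ := Ωs⁻¹ * E * P * Eᴴ * Ωs⁻¹;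
    Ω⁻¹ * Hc * Sig = Sighat * Hc * Ωh⁻¹ := by
  intro P Sig Sighat
  set D : Matrix (Fin r) (Fin r) ℂ := Matrix.diagonal fun i => ((δ i : ℝ) : ℂ)
  have hDP : D * P = P * D := Matrix.commute_diagonal _ _
  calc Ω⁻¹ * Hc * Sig
      = Ωs⁻¹ * (Ωs⁻¹ * Hc * Ωhs⁻¹) * G * P * Gᴴ * Ωhs⁻¹ := by
        simp only [Sig, ← hΩssq, Matrix.mul_inv_rev, Matrix.mul_assoc]
    _ = Ωs⁻¹ * E * D * (Gᴴ * G) * P * Gᴴ * Ωhs⁻¹ := by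
        rw [hSVD]
        simp only [Matrix.mul_assoc]
    _ = Ωs⁻¹ * E * (D * P) * Gᴴ * Ωhs⁻¹ := by
        rw [hG, Matrix.mul_one]
        simp only [Matrix.mul_assoc]
    _ = Ωs⁻¹ * E * P * (Eᴴ * E) * D * Gᴴ * Ωhs⁻¹ := by
        rw [hDP, hE, Matrix.mul_one]
        simp only [Matrix.mul_assoc]
    _ = Ωs⁻¹ * E * P * Eᴴ * (Ωs⁻¹ * Hc * Ωhs⁻¹) * Ωhs⁻¹ := by
        rw [hSVD]
        simp only [Matrix.mul_assoc]
    _ = Sighat * Hc * Ωh⁻¹ := by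
        simp only [Sighat, ← hΩhssq, Matrix.mul_inv_rev, Matrix.mul_assoc]
end

section
/- (Single-link rate duality under the polite water-filling structure.) Let Ω ∈ ℂ^{n×n} and Ω̂ ∈ ℂ^{m×m} be Hermitian positive definite, Ȟ ∈ ℂ^{n×m}, and w > 0 a real number. Suppose E ∈ ℂ^{n×r} and G ∈ ℂ^{m×r} satisfy EᴴE = I_r and GᴴG = I_r, and Δ ∈ ℝ^{r×r} is a diagonal matrix with strictly positive diagonal entries δ_1,…,δ_r, such that Ω^{-1/2} Ȟ Ω̂^{-1/2} = E Δ Gᴴ. Let P be the r×r diagonal matrix with diagonal entries max(w − δ_i^{-2}, 0), and define Σ = Ω̂^{-1/2} G P Gᴴ Ω̂^{-1/2} and Σ̂ = Ω^{-1/2} E P Eᴴ Ω^{-1/2}. Then det(I_n + Ȟ Σ Ȟᴴ Ω^{-1}) = det(I_m + Ȟᴴ Σ̂ Ȟ Ω̂^{-1}) = ∏_{i=1}^r max(w δ_i², 1). -/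
open Matrix
open scoped ComplexOrder

/-- If `S⁻¹ * H * T⁻¹ = E * D * Gᴴ` with `E`, `G` having orthonormal columns, then the rate
determinant of the input covariance `T⁻¹ * G * P * Gᴴ * T⁻¹` reduces to the `r × r` core. -/
theorem det_one_add_of_whitened_eq {n m r : Type*} [Fintype n] [Fintype m] [Fintype r]
    [DecidableEq n] [DecidableEq m] [DecidableEq r]
    {S : Matrix n n ℂ} {T : Matrix m m ℂ} {H : Matrix n m ℂ} {E : Matrix n r ℂ}
    {G : Matrix m r ℂ} {D : Matrix r r ℂ} (P : Matrix r r ℂ)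
    (hS : S.IsHermitian) (hSu : IsUnit S.det) (hT : T.IsHermitian)
    (hE : Eᴴ * E = 1) (hG : Gᴴ * G = 1) (h : S⁻¹ * H * T⁻¹ = E * D * Gᴴ) :
    (1 + H * (T⁻¹ * G * P * Gᴴ * T⁻¹) * Hᴴ * (S * S)⁻¹).det = (1 + D * P * Dᴴ).det := by
  have hHT : H * T⁻¹ = S * (E * D * Gᴴ) := by
    rw [← h, Matrix.mul_assoc, mul_nonsing_inv_cancel_left _ _ hSu]
  have hTH : T⁻¹ * Hᴴ = G * Dᴴ * Eᴴ * S := by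
    simpa [conjTranspose_nonsing_inv, hT.eq, hS.eq, Matrix.mul_assoc]
      using congrArg conjTranspose hHT
  have key : H * (T⁻¹ * G * P * Gᴴ * T⁻¹) * Hᴴ * (S * S)⁻¹
      = (S * E * (D * P * Dᴴ)) * (Eᴴ * S⁻¹) := by
    calc _ = (H * T⁻¹) * (G * P * Gᴴ) * (T⁻¹ * Hᴴ) * (S⁻¹ * S⁻¹) := by
          rw [Matrix.mul_inv_rev]; simp only [Matrix.mul_assoc]
      _ = S * E * D * (Gᴴ * G) * P * (Gᴴ * G) * Dᴴ * Eᴴ * (S * S⁻¹) * S⁻¹ := by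
          rw [hHT, hTH]; simp only [Matrix.mul_assoc]
      _ = _ := by
          rw [hG, mul_nonsing_inv _ hSu]; simp only [Matrix.mul_assoc, Matrix.mul_one]
  have core : (Eᴴ * S⁻¹) * (S * E * (D * P * Dᴴ)) = D * P * Dᴴ := by
    calc _ = Eᴴ * (S⁻¹ * S) * E * (D * P * Dᴴ) := by simp only [Matrix.mul_assoc]
      _ = _ := by rw [nonsing_inv_mul _ hSu, Matrix.mul_one, hE, Matrix.one_mul]
  rw [key, det_one_add_mul_comm, core]

/-- The water-filling power `max (w - x⁻²) 0` yields the gain `max (w * x²) 1`. -/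
theorem one_add_mul_waterfilling_mul (w : ℝ) {x : ℝ} (hx : 0 < x) :
    1 + x * max (w - (x ^ 2)⁻¹) 0 * x = max (w * x ^ 2) 1 := by
  have hx2 : (0 : ℝ) ≤ x ^ 2 := by positivity
  calc 1 + x * max (w - (x ^ 2)⁻¹) 0 * x = 1 + max (w - (x ^ 2)⁻¹) 0 * x ^ 2 := by ring
    _ = max (w * x ^ 2) 1 := by
      rw [max_mul_of_nonneg _ _ hx2, ← max_add_add_left, sub_mul,
        inv_mul_cancel₀ (by positivity)]
      ring_nf

/-- single-link rate duality under the polite water-filling structure: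
with `Ωs = Ω^{1/2}`, `Ωhs = Ω̂^{1/2}` the (unique) Hermitian positive definite square
roots, the thin SVD `Ω^{-1/2} Ȟ Ω̂^{-1/2} = E Δ Gᴴ`, `P = diag(max(w − δ_i⁻², 0))`,
`Σ = Ω̂^{-1/2} G P Gᴴ Ω̂^{-1/2}` and `Σ̂ = Ω^{-1/2} E P Eᴴ Ω^{-1/2}`, one has
`det(I + Ȟ Σ Ȟᴴ Ω⁻¹) = det(I + Ȟᴴ Σ̂ Ȟ Ω̂⁻¹) = ∏_i max(w δ_i², 1)`. -/
theorem stmt11 (n m r : ℕ)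
    (Ω Ωs : Matrix (Fin n) (Fin n) ℂ) (hΩ : Ω.PosDef)
    (hΩs : Ωs.PosDef) (hΩssq : Ωs * Ωs = Ω)
    (Ωh Ωhs : Matrix (Fin m) (Fin m) ℂ) (hΩh : Ωh.PosDef)
    (hΩhs : Ωhs.PosDef) (hΩhssq : Ωhs * Ωhs = Ωh)
    (Hc : Matrix (Fin n) (Fin m) ℂ)
    (w : ℝ) (hw : 0 < w)
    (E : Matrix (Fin n) (Fin r) ℂ) (G : Matrix (Fin m) (Fin r) ℂ)
    (hE : Eᴴ * E = 1) (hG : Gᴴ * G = 1)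
    (δ : Fin r → ℝ) (hδ : ∀ i, 0 < δ i)
    (hSVD : Ωs⁻¹ * Hc * Ωhs⁻¹ = E * Matrix.diagonal (fun i => ((δ i : ℝ) : ℂ)) * Gᴴ) :
    let P : Matrix (Fin r) (Fin r) ℂ :=
      Matrix.diagonal fun i => ((max (w - ((δ i) ^ 2)⁻¹) 0 : ℝ) : ℂ);
    let Sig : Matrix (Fin m) (Fin m) ℂ := Ωhs⁻¹ * G * P * Gᴴ * Ωhs⁻¹;
    let Sighat : Matrix (Fin n) (Fin n) ℂ := Ωs⁻¹ * E * P * Eᴴ * Ωs⁻¹;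
    (1 + Hc * Sig * Hcᴴ * Ω⁻¹).det = (1 + Hcᴴ * Sighat * Hc * Ωh⁻¹).det
      ∧ (1 + Hc * Sig * Hcᴴ * Ω⁻¹).det = ((∏ i, max (w * (δ i) ^ 2) 1 : ℝ) : ℂ) := by
  intro P Sig Sighat
  set D : Matrix (Fin r) (Fin r) ℂ := Matrix.diagonal fun i => ((δ i : ℝ) : ℂ) with hD
  have hDH : Dᴴ = D := by
    rw [hD, diagonal_conjTranspose]
    congr 1
    ext i
    simp
  have hSVD' : Ωhs⁻¹ * Hcᴴ * Ωs⁻¹ = G * D * Eᴴ := by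
    simpa [conjTranspose_nonsing_inv, hΩs.isHermitian.eq, hΩhs.isHermitian.eq, hDH,
      Matrix.mul_assoc] using congrArg conjTranspose hSVD
  have hfwd := det_one_add_of_whitened_eq P hΩs.isHermitian hΩs.det_pos.ne'.isUnit
    hΩhs.isHermitian hE hG hSVD
  have hrev := det_one_add_of_whitened_eq P hΩhs.isHermitian hΩhs.det_pos.ne'.isUnit
    hΩs.isHermitian hG hE hSVD'
  rw [hΩssq] at hfwd
  rw [hΩhssq, conjTranspose_conjTranspose] at hrev
  refine ⟨hfwd.trans hrev.symm, hfwd.trans ?_⟩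
  rw [hDH, hD, diagonal_mul_diagonal, diagonal_mul_diagonal, ← diagonal_one, diagonal_add,
    det_diagonal, Complex.ofReal_prod]
  refine Finset.prod_congr rfl fun i _ => ?_
  rw [← one_add_mul_waterfilling_mul w (hδ i)]
  push_cast
  rfl
end

section
/- (Single-user water-filling optimality, eq. (GWFsolution).) Let H̄ ∈ ℂ^{n×m}, let W̄ ∈ ℂ^{n×n} and Ŵ ∈ ℂ^{m×m} be Hermitian positive definite. Suppose E ∈ ℂ^{n×r} and G ∈ ℂ^{m×r} satisfy EᴴE = I_r and GᴴG = I_r, and Δ ∈ ℝ^{r×r} is a diagonal matrix with strictly positive diagonal entries δ_1,…,δ_r, such that W̄^{-1/2} H̄ Ŵ^{-1/2} = E Δ Gᴴ. Let P be the r×r diagonal matrix with diagonal entries max(1 − δ_i^{-2}, 0), and define Σ* = Ŵ^{-1/2} G P Gᴴ Ŵ^{-1/2}. Then Σ* is Hermitian positive semidefinite and for every Hermitian positive semidefinite Σ ∈ ℂ^{m×m}: log det(H̄ Σ H̄ᴴ + W̄) − Tr(Σ Ŵ) ≤ log det(H̄ Σ* H̄ᴴ + W̄) − Tr(Σ* Ŵ),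 where for Hermitian positive definite matrices the determinant is a positive real number and the traces are real. -/
open Matrix
open scoped ComplexOrder

/-- The tangent-line inequality for `log det` at the identity. -/
theorem log_det_re_le_trace_sub_card {ι : Type*} [Fintype ι] [DecidableEq ι]
    {A : Matrix ι ι ℂ} (hA : A.PosDef) :
    Real.log A.det.re ≤ A.trace.re - Fintype.card ι := by
  have hdet : A.det.re = ∏ i, hA.1.eigenvalues i := by
    rw [hA.1.det_eq_prod_eigenvalues]
    norm_cast
  have htr : A.trace.re = ∑ i, hA.1.eigenvalues i := by
    rw [hA.1.trace_eq_sum_eigenvalues]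
    norm_cast
  rw [hdet, htr, Real.log_prod fun i _ => (hA.eigenvalues_pos i).ne']
  calc ∑ i, Real.log (hA.1.eigenvalues i) ≤ ∑ i, (hA.1.eigenvalues i - 1) :=
        Finset.sum_le_sum fun i _ => Real.log_le_sub_one_of_pos (hA.eigenvalues_pos i)
    _ = _ := by simp

/-- The tangent-line inequality for `log det` at a positive diagonal matrix `diag(c)`. -/
theorem log_det_re_le_of_diagonal {ι : Type*} [Fintype ι] [DecidableEq ι]
    {A : Matrix ι ι ℂ} (hA : A.PosDef) (c : ι → ℝ) (hc : ∀ i, 0 < c i) :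
    Real.log A.det.re ≤ ∑ i, (Real.log (c i) + (A i i).re / c i - 1) := by
  set D : Matrix ι ι ℂ := diagonal fun i => (((√(c i))⁻¹ : ℝ) : ℂ) with hD
  have hDH : Dᴴ = D := by
    rw [hD, diagonal_conjTranspose]
    congr 1
    ext i
    simp
  have hs : ∀ i, 0 < √(c i) := fun i => Real.sqrt_pos.2 (hc i)
  have hDu : IsUnit D := by
    rw [isUnit_iff_isUnit_det, hD, det_diagonal, isUnit_iff_ne_zero, Finset.prod_ne_zero_iff]
    intro i _
    exact_mod_cast (inv_pos.2 (hs i)).ne'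
  have hB : (D * A * D).PosDef := by
    have := hA.conjTranspose_mul_mul_same (B := D) (mulVec_injective_of_isUnit hDu)
    rwa [hDH] at this
  have hApos := (Complex.pos_iff.1 hA.det_pos).1
  have hdet : (D * A * D).det.re = (∏ i, c i)⁻¹ * A.det.re := by
    have hDD : D.det * D.det = (((∏ i, c i)⁻¹ : ℝ) : ℂ) := by
      rw [hD, det_diagonal, ← Finset.prod_mul_distrib, ← Finset.prod_inv_distrib]
      push_cast
      refine Finset.prod_congr rfl fun i _ => ?_
      rw [← mul_inv]
      norm_cast
      rw [Real.mul_self_sqrt (hc i).le]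
    rw [det_mul, det_mul, mul_right_comm, hDD, Complex.re_ofReal_mul]
  have htr : (D * A * D).trace.re = ∑ i, (A i i).re / c i := by
    rw [trace, Complex.re_sum]
    refine Finset.sum_congr rfl fun i _ => ?_
    rw [diag_apply, hD, mul_diagonal, diagonal_mul, Complex.re_mul_ofReal, Complex.re_ofReal_mul,
      mul_right_comm, ← mul_inv, Real.mul_self_sqrt (hc i).le, div_eq_inv_mul]
  have h := log_det_re_le_trace_sub_card hB
  have hcp : 0 < ∏ i, c i := Finset.prod_pos fun i _ => hc i
  rw [hdet, htr, Real.log_mul (inv_pos.2 hcp).ne' hApos.ne', Real.log_inv,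
    Real.log_prod fun i _ => (hc i).ne'] at h
  simp only [Finset.sum_sub_distrib, Finset.sum_add_distrib, Finset.sum_const, Finset.card_univ,
    nsmul_eq_mul, mul_one]
  linarith

/-- Compressing a positive semidefinite matrix along an isometry does not increase its trace. -/
theorem trace_re_conjTranspose_mul_mul_le {ι κ : Type*} [Fintype ι] [DecidableEq ι]
    [Fintype κ] [DecidableEq κ] {Q : Matrix ι ι ℂ} (hQ : Q.PosSemidef)
    {G : Matrix ι κ ℂ} (hG : Gᴴ * G = 1) :
    (Gᴴ * Q * G).trace.re ≤ Q.trace.re := by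
  set R : Matrix ι ι ℂ := 1 - G * Gᴴ with hR
  have hRH : Rᴴ = R := by simp [hR]
  have hRR : R * R = R := by
    have : G * Gᴴ * (G * Gᴴ) = G * Gᴴ := by
      rw [Matrix.mul_assoc, ← Matrix.mul_assoc Gᴴ, hG, Matrix.one_mul]
    rw [hR, Matrix.sub_mul, Matrix.mul_sub, Matrix.mul_sub, this]
    simp
  have h := (hQ.conjTranspose_mul_mul_same R).trace_nonneg
  rw [hRH, trace_mul_comm, ← Matrix.mul_assoc, hRR, hR, Matrix.sub_mul, Matrix.one_mul,
    trace_sub, Matrix.mul_assoc, trace_mul_comm G] at h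
  have := (Complex.nonneg_iff.1 h).1
  rw [Complex.sub_re] at this
  linarith

/-- The scalar water-filling bound: the tangent at `max (d²) 1` bounds every `s ≥ 0` by the value
at the water-filling level `max (1 - d⁻²) 0`. -/
theorem waterfilling_scalar_le {d s : ℝ} (hd : 0 < d) (hs : 0 ≤ s) :
    Real.log (1 + d * max (1 - (d ^ 2)⁻¹) 0 * d)
        + (1 + d * s * d) / (1 + d * max (1 - (d ^ 2)⁻¹) 0 * d) - 1 - s
      ≤ Real.log (1 + d * max (1 - (d ^ 2)⁻¹) 0 * d) - max (1 - (d ^ 2)⁻¹) 0 := by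
  rcases le_total 1 (d ^ 2) with h | h
  · have h1 : (d ^ 2)⁻¹ ≤ 1 := inv_le_one_of_one_le₀ h
    rw [max_eq_left (by linarith)]
    have h2 : 1 + d * (1 - (d ^ 2)⁻¹) * d = d ^ 2 := by
      field_simp
      ring
    have h3 : (1 + d * s * d) / d ^ 2 = (d ^ 2)⁻¹ + s := by
      field_simp
    rw [h2, h3]
    linarith
  · have h1 : 1 ≤ (d ^ 2)⁻¹ := (one_le_inv₀ (by positivity)).2 h
    rw [max_eq_right (by linarith)]
    have : d * s * d ≤ s := by nlinarith
    simp
    linarith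

/-- The determinant in the rate expression, reduced along a singular value decomposition of the
whitened channel. -/
theorem det_rate_eq {ι κ ρ : Type*} [Fintype ι] [DecidableEq ι] [Fintype κ] [DecidableEq κ]
    [Fintype ρ] [DecidableEq ρ] {T : Matrix ι ι ℂ} {U : Matrix κ κ ℂ}
    (hT : T.PosDef) (hU : U.PosDef) {H : Matrix ι κ ℂ} {E : Matrix ι ρ ℂ} {G : Matrix κ ρ ℂ}
    {D : Matrix ρ ρ ℂ} (hE : Eᴴ * E = 1) (hD : Dᴴ = D) (hSVD : T⁻¹ * H * U⁻¹ = E * D * Gᴴ)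
    (X : Matrix κ κ ℂ) :
    (H * X * Hᴴ + T * T).det = (T * T).det * (1 + D * (Gᴴ * (U * X * U) * G) * D).det := by
  have hTd := (isUnit_iff_isUnit_det T).1 hT.isUnit
  have hUd := (isUnit_iff_isUnit_det U).1 hU.isUnit
  have hH : H = T * (E * D * Gᴴ) * U := by
    rw [← hSVD, Matrix.mul_assoc T⁻¹, mul_nonsing_inv_cancel_left _ _ hTd,
      nonsing_inv_mul_cancel_right _ _ hUd]
  have hHH : Hᴴ = U * G * D * Eᴴ * T := by
    rw [hH]
    simp only [conjTranspose_mul, conjTranspose_conjTranspose, hT.1.eq, hU.1.eq, hD,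
      Matrix.mul_assoc]
  have key : H * X * Hᴴ + T * T
      = T * (1 + E * (D * (Gᴴ * (U * X * U) * G) * D * Eᴴ)) * T := by
    rw [hHH, hH]
    simp only [Matrix.mul_add, Matrix.add_mul, Matrix.mul_assoc, Matrix.mul_one]
    rw [add_comm]
  rw [key, det_mul, det_mul, det_one_add_mul_comm, Matrix.mul_assoc _ Eᴴ, hE, Matrix.mul_one,
    det_mul]
  ring

/-- single-user water-filling optimality, eq. (GWFsolution): with
`SWb = W̄^{1/2}` and `SWh = Ŵ^{1/2}` the (unique) Hermitian positive definite square
roots, the thin SVD `W̄^{-1/2} H̄ Ŵ^{-1/2} = E Δ Gᴴ`, `P = diag(max(1 − δ_i⁻², 0))` and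
`Σ* = Ŵ^{-1/2} G P Gᴴ Ŵ^{-1/2}`, the matrix `Σ*` is Hermitian positive semidefinite and
maximizes `log det(H̄ Σ H̄ᴴ + W̄) − Tr(Σ Ŵ)` over all Hermitian positive semidefinite `Σ`.
(For positive definite matrices the determinant is a positive real number, extracted
here via the real part; similarly the traces are real.) -/
theorem stmt12 (n m r : ℕ)
    (Hb : Matrix (Fin n) (Fin m) ℂ)
    (Wb SWb : Matrix (Fin n) (Fin n) ℂ) (hWb : Wb.PosDef)
    (hSWb : SWb.PosDef) (hSWbsq : SWb * SWb = Wb)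
    (Wh SWh : Matrix (Fin m) (Fin m) ℂ) (hWh : Wh.PosDef)
    (hSWh : SWh.PosDef) (hSWhsq : SWh * SWh = Wh)
    (E : Matrix (Fin n) (Fin r) ℂ) (G : Matrix (Fin m) (Fin r) ℂ)
    (hE : Eᴴ * E = 1) (hG : Gᴴ * G = 1)
    (δ : Fin r → ℝ) (hδ : ∀ i, 0 < δ i)
    (hSVD : SWb⁻¹ * Hb * SWh⁻¹ = E * Matrix.diagonal (fun i => ((δ i : ℝ) : ℂ)) * Gᴴ) :
    let P : Matrix (Fin r) (Fin r) ℂ :=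
      Matrix.diagonal fun i => ((max (1 - ((δ i) ^ 2)⁻¹) 0 : ℝ) : ℂ);
    let SigStar : Matrix (Fin m) (Fin m) ℂ := SWh⁻¹ * G * P * Gᴴ * SWh⁻¹;
    SigStar.PosSemidef ∧
      ∀ Sig : Matrix (Fin m) (Fin m) ℂ, Sig.PosSemidef →
        Real.log ((Hb * Sig * Hbᴴ + Wb).det.re) - ((Sig * Wh).trace.re)
          ≤ Real.log ((Hb * SigStar * Hbᴴ + Wb).det.re) - ((SigStar * Wh).trace.re) := by
  intro P SigStar
  set D : Matrix (Fin r) (Fin r) ℂ := diagonal fun i => ((δ i : ℝ) : ℂ) with hD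
  set p : Fin r → ℝ := fun i => max (1 - ((δ i) ^ 2)⁻¹) 0 with hp
  have hPd : P = diagonal fun i => (p i : ℂ) := rfl
  have hDH : Dᴴ = D := by
    rw [hD, diagonal_conjTranspose]
    congr 1
    ext i
    simp
  have hp0 : ∀ i, 0 ≤ p i := fun i => le_max_right _ _
  have hP : P.PosSemidef := by
    rw [hPd, posSemidef_diagonal_iff]
    intro i
    exact_mod_cast hp0 i
  have hUd := (isUnit_iff_isUnit_det SWh).1 hSWh.isUnit
  have hWbpos := (Complex.pos_iff.1 hWb.det_pos).1
  have hQstar : SWh * SigStar * SWh = G * P * Gᴴ := by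
    simp only [SigStar, Matrix.mul_assoc]
    rw [nonsing_inv_mul _ hUd, mul_nonsing_inv_cancel_left _ _ hUd, Matrix.mul_one]
  have hSstar : Gᴴ * (SWh * SigStar * SWh) * G = P := by
    rw [hQstar, Matrix.mul_assoc, Matrix.mul_assoc (G * P), hG, Matrix.mul_one,
      ← Matrix.mul_assoc, hG, Matrix.one_mul]
  have hStar : SigStar.PosSemidef := by
    have := hP.mul_mul_conjTranspose_same (SWh⁻¹ * G)
    rw [conjTranspose_mul, conjTranspose_nonsing_inv, hSWh.1.eq] at this
    simpa only [SigStar, Matrix.mul_assoc] using this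
  refine ⟨hStar, fun Sig hSig => ?_⟩
  have htrace : ∀ X : Matrix (Fin m) (Fin m) ℂ, (X * Wh).trace = (SWh * X * SWh).trace := by
    intro X
    rw [← hSWhsq, ← Matrix.mul_assoc, trace_mul_comm, ← Matrix.mul_assoc]
  have hcompress : ∀ X : Matrix (Fin m) (Fin m) ℂ, X.PosSemidef →
      (Gᴴ * (SWh * X * SWh) * G).PosSemidef := by
    intro X hX
    have := (hX.conjTranspose_mul_mul_same SWh).conjTranspose_mul_mul_same G
    rwa [hSWh.1.eq] at this
  have hpd : ∀ S : Matrix (Fin r) (Fin r) ℂ, S.PosSemidef → (1 + D * S * D).PosDef := by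
    intro S hS
    have := hS.conjTranspose_mul_mul_same D
    rw [hDH] at this
    exact PosDef.one.add_posSemidef this
  have hlog : ∀ X : Matrix (Fin m) (Fin m) ℂ, X.PosSemidef →
      Real.log (Hb * X * Hbᴴ + Wb).det.re = Real.log Wb.det.re
        + Real.log (1 + D * (Gᴴ * (SWh * X * SWh) * G) * D).det.re := by
    intro X hX
    have h1 := Complex.pos_iff.1 (hpd _ (hcompress X hX)).det_pos
    rw [← hSWbsq, det_rate_eq hSWb hSWh hE hDH hSVD, hSWbsq, Complex.mul_re, ← h1.2, mul_zero,
      sub_zero, Real.log_mul hWbpos.ne' h1.1.ne']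
  rw [hlog _ hSig, hlog _ hStar, htrace, htrace, hSstar]
  set S := Gᴴ * (SWh * Sig * SWh) * G with hS
  have hSpsd : S.PosSemidef := hcompress Sig hSig
  have htr : S.trace.re ≤ (SWh * Sig * SWh).trace.re := by
    refine trace_re_conjTranspose_mul_mul_le ?_ hG
    have := hSig.conjTranspose_mul_mul_same SWh
    rwa [hSWh.1.eq] at this
  have htrStar : (SWh * SigStar * SWh).trace.re = ∑ i, p i := by
    rw [hQstar, trace_mul_comm, ← Matrix.mul_assoc, hG, Matrix.one_mul, hPd, trace_diagonal,
      Complex.re_sum]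
    simp
  have hcpos : ∀ i, 0 < 1 + δ i * p i * δ i := fun i => by
    have := mul_nonneg (mul_nonneg (hδ i).le (hp0 i)) (hδ i).le
    linarith
  have hdetStar : Real.log (1 + D * P * D).det.re
      = ∑ i, Real.log (1 + δ i * p i * δ i) := by
    have : 1 + D * P * D = diagonal fun i => ((1 + δ i * p i * δ i : ℝ) : ℂ) := by
      rw [hD, hPd, diagonal_mul_diagonal, diagonal_mul_diagonal, ← diagonal_one, diagonal_add]
      simp
    rw [this, det_diagonal, ← Complex.ofReal_prod, Complex.ofReal_re,
      Real.log_prod fun i _ => (hcpos i).ne']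
  have hbound := log_det_re_le_of_diagonal (hpd S hSpsd) _ hcpos
  have hentry : ∀ i, ((1 + D * S * D) i i).re = 1 + δ i * (S i i).re * δ i := by
    intro i
    rw [Matrix.add_apply, one_apply_eq, hD, mul_diagonal, diagonal_mul, Complex.add_re,
      Complex.re_mul_ofReal, Complex.re_ofReal_mul, Complex.one_re]
  have hsum : ∑ i, (Real.log (1 + δ i * p i * δ i)
        + ((1 + D * S * D) i i).re / (1 + δ i * p i * δ i) - 1) - S.trace.re
      ≤ ∑ i, Real.log (1 + δ i * p i * δ i) - ∑ i, p i := by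
    rw [trace, Complex.re_sum, ← Finset.sum_sub_distrib, ← Finset.sum_sub_distrib]
    refine Finset.sum_le_sum fun i _ => ?_
    rw [hentry]
    exact waterfilling_scalar_le (hδ i) (Complex.nonneg_iff.1 hSpsd.diag_nonneg).1
  rw [htrStar, hdetStar]
  linarith
end
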